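/- Let P be a finite poset with iir(P) = |P|, and let Q be a non-empty up-set of P. Then Q belongs to NMIIR; that is, either iir(Q) = |Q|, or iir(Q) = |Q| − 1 and the first block in the block decomposition Q = R₁ < ⋯ < R_s is a chain. -/

import Mathlib

open scoped Classical

/-- `S` is an inclusion representation of the poset `α`. -/
def IsRepr {α β : Type} [PartialOrder α] (S : α → Finset β) : Prop :=
  ∀ x y : α, x ≤ y ↔ S x ⊆ S y

/-- The ground set of a representation. -/
noncomputable def ground {α β : Type} [Fintype α] (S : α → Finset β) : Finset β :=
  Finset.univ.biUnion S

/-- `S` is a reduction of `T`. -/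
def IsReduction {α β γ : Type} [Fintype α] (S : α → Finset β) (T : α → Finset γ) : Prop :=
  (ground S).card ≤ (ground T).card ∧ ∀ x, (S x).card ≤ (T x).card

/-- An inclusion representation is irreducible if it admits no strict reduction. -/
def IrreducibleRepr {α β : Type} [PartialOrder α] [Fintype α] (S : α → Finset β) : Prop :=
  IsRepr S ∧ ∀ T : α → Finset ℕ, IsRepr T → IsReduction T S → IsReduction S T

/-- Maximum ground-set size over irreducible inclusion representations. -/
noncomputable def iir (α : Type) [PartialOrder α] [Fintype α] : ℕ :=
  sSup {w | ∃ S : α → Finset ℕ, IrreducibleRepr S ∧ (ground S).card = w}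

/-- Cube height. -/
noncomputable def chHeight (α : Type) [PartialOrder α] [Fintype α] : ℕ :=
  sInf {h | ∃ S : α → Finset ℕ, IsRepr S ∧ ∀ x, (S x).card ≤ h}

/-- 2-dimension. -/
noncomputable def dim2 (α : Type) [PartialOrder α] [Fintype α] : ℕ :=
  sInf {w | ∃ S : α → Finset ℕ, IsRepr S ∧ (ground S).card = w}

/-- Cube width. -/
noncomputable def cw (α : Type) [PartialOrder α] [Fintype α] : ℕ :=
  sInf {w | ∃ S : α → Finset ℕ, IsRepr S ∧ (ground S).card = w ∧ ∀ x, (S x).card ≤ chHeight α}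

/-- Closed down-set `D_P[x]` as a finset. -/
noncomputable def downSet {α : Type} [PartialOrder α] [Fintype α] (x : α) : Finset α :=
  Finset.univ.filter (· ≤ x)

/-- The canonical inclusion representation. -/
noncomputable def canonical (α : Type) [PartialOrder α] [Fintype α] : α → Finset α :=
  fun x => downSet x

/-- No Block is a Chain Property. -/
def NoBlockChain (α : Type) [PartialOrder α] : Prop :=
  ∀ x : α, ∃ y : α, ¬ x ≤ y ∧ ¬ y ≤ x

/-- Two Down Property. -/
def TwoDown (α : Type) [PartialOrder α] : Prop :=
  ∀ y : α, (∃ a b : α, a ≠ b ∧ a ⋖ y ∧ b ⋖ y) →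
    ∃ z : α, (∀ u : α, u < y → u < z) ∧ ¬ y ≤ z ∧ ¬ z ≤ y

/-- Parallel Pair Property. -/
def ParallelPair (α : Type) [PartialOrder α] : Prop :=
  ∀ x y : α, ¬ x ≤ y → ¬ y ≤ x →
    (∃ y' : α, (∀ u : α, u < x → u < y') ∧ y ≤ y' ∧ ¬ x ≤ y' ∧ ¬ y' ≤ x) ∨
    (∃ x' : α, (∀ u : α, u < y → u < x') ∧ x ≤ x' ∧ ¬ y ≤ x' ∧ ¬ x' ≤ y)

/-- A vertical decomposition of a poset into two non-empty parts. -/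
def IsVerticalDecomp {α : Type} [PartialOrder α] (A B : Set α) : Prop :=
  A.Nonempty ∧ B.Nonempty ∧ (∀ x, x ∈ A ∨ x ∈ B) ∧ ∀ x ∈ A, ∀ y ∈ B, x < y

/-- A block is a chain or a vertical prime. -/
def IsBlock (α : Type) [PartialOrder α] : Prop :=
  (∀ x y : α, x ≤ y ∨ y ≤ x) ∨ ¬ ∃ A B : Set α, IsVerticalDecomp A B

section Representations

variable {α β γ : Type}

theorem mem_ground [Fintype α] {S : α → Finset β} {b : β} : b ∈ ground S ↔ ∃ x, b ∈ S x := by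
  simp [ground]

theorem mem_downSet [PartialOrder α] [Fintype α] {x y : α} : y ∈ downSet x ↔ y ≤ x := by
  simp [downSet]

theorem ground_canonical [PartialOrder α] [Fintype α] : ground (canonical α) = Finset.univ := by
  ext x
  simpa [mem_ground, canonical, mem_downSet] using ⟨x, le_rfl⟩

theorem isRepr_canonical [PartialOrder α] [Fintype α] : IsRepr (canonical α) := by
  intro x y
  refine ⟨fun h z hz => mem_downSet.2 ((mem_downSet.1 hz).trans h), fun h => ?_⟩
  exact mem_downSet.1 (h (mem_downSet.2 le_rfl))

theorem isRepr_map [PartialOrder α] {S : α → Finset β} (hS : IsRepr S) (f : β ↪ γ) :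
    IsRepr fun x => (S x).map f := by
  intro x y
  rw [hS x y, Finset.map_subset_map]

theorem card_ground_map [Fintype α] (S : α → Finset β) (f : β ↪ γ) :
    (ground fun x => (S x).map f).card = (ground S).card := by
  rw [← Finset.card_map f]
  congr 1
  ext c
  simp only [mem_ground, Finset.mem_map]
  grind

/-- Irreducibility may be tested against representations over any countable type. -/
theorem IrreducibleRepr.isReduction [PartialOrder α] [Fintype α] [Countable γ]
    {S : α → Finset β} (hS : IrreducibleRepr S) {T : α → Finset γ} (hT : IsRepr T)
    (hTS : IsReduction T S) : IsReduction S T := by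
  obtain ⟨f, hf⟩ := exists_injective_nat γ
  have h := hS.2 (fun x => (T x).map ⟨f, hf⟩) (isRepr_map hT _)
    ⟨by rw [card_ground_map]; exact hTS.1, fun x => by rw [Finset.card_map]; exact hTS.2 x⟩
  simpa only [IsReduction, card_ground_map, Finset.card_map] using h

/-- If the elements outside `A` have representatives `f x ∈ S x`, pairwise distinct and lying in
no `S a` with `a ∈ A`, the points of `S` lying in no `S a` may be replaced by principal up-sets. -/
theorem exists_repr_of_injective [PartialOrder α] [Fintype α] {S : α → Finset β} (hS : IsRepr S)
    (A : Finset α) (f : {x // x ∉ A} → β) (hf : Function.Injective f)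
    (hfS : ∀ x : {x // x ∉ A}, f x ∈ S x \ A.biUnion S) :
    ∃ T : α → Finset β, IsRepr T ∧ (∀ x, T x ⊆ S x) ∧
      (ground T).card + A.card ≤ (A.biUnion S).card + Fintype.card α ∧
      ∀ y, (downSet y \ A).card ≤ (T y).card := by
  let T : α → Finset β := fun y =>
    (S y ∩ A.biUnion S) ∪ (Finset.univ.filter fun x : {x // x ∉ A} => x.1 ≤ y).image f
  have hTS : ∀ x, T x ⊆ S x := by
    intro y b hb
    simp only [T, Finset.mem_union, Finset.mem_inter, Finset.mem_image, Finset.mem_filter,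
      Finset.mem_univ, true_and] at hb
    obtain hb | ⟨x, hx, rfl⟩ := hb
    · exact hb.1
    · exact (hS _ _).1 hx (Finset.mem_sdiff.1 (hfS x)).1
  refine ⟨T, ?_, hTS, ?_, ?_⟩
  · intro x y
    constructor
    · intro h
      refine Finset.union_subset_union (Finset.inter_subset_inter_right ((hS x y).1 h))
        (Finset.image_subset_image fun z hz => ?_)
      simp only [Finset.mem_filter, Finset.mem_univ, true_and] at hz ⊢
      exact hz.trans h
    · intro h
      by_cases hx : x ∈ A
      · refine (hS x y).2 fun b hb => hTS y (h (Finset.mem_union_left _ ?_))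
        exact Finset.mem_inter.2 ⟨hb, Finset.mem_biUnion.2 ⟨x, hx, hb⟩⟩
      · have hb : f ⟨x, hx⟩ ∈ T y := by
          apply h
          refine Finset.mem_union_right _ (Finset.mem_image.2 ⟨⟨x, hx⟩, ?_, rfl⟩)
          simp
        obtain hb | hb := Finset.mem_union.1 hb
        · exact absurd (Finset.mem_inter.1 hb).2 (Finset.mem_sdiff.1 (hfS _)).2
        · obtain ⟨z, hz, hzx⟩ := Finset.mem_image.1 hb
          rw [hf hzx] at hz
          exact (Finset.mem_filter.1 hz).2
  · have hsub : ground T ⊆ A.biUnion S ∪ Finset.univ.image f := by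
      intro b hb
      obtain ⟨x, hx⟩ := mem_ground.1 hb
      refine Finset.union_subset_union Finset.inter_subset_right
        (Finset.image_subset_image (Finset.filter_subset _ _)) hx
    have h₁ := (Finset.card_le_card hsub).trans (Finset.card_union_le _ _)
    rw [Finset.card_image_of_injective _ hf, Finset.card_univ, Fintype.card_subtype_compl,
      Fintype.card_coe] at h₁
    have h₂ := Finset.card_le_univ A
    omega
  · intro y
    have h : downSet y \ A =
        (Finset.univ.filter fun x : {x // x ∉ A} => x.1 ≤ y).image Subtype.val := by
      ext z
      simp only [Finset.mem_sdiff, mem_downSet, Finset.mem_image, Finset.mem_filter,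
        Finset.mem_univ, true_and, Subtype.exists, exists_and_right, exists_eq_right]
      tauto
    rw [h, Finset.card_image_of_injective _ Subtype.val_injective,
      ← Finset.card_image_of_injective _ hf]
    exact Finset.card_le_card Finset.subset_union_right

/-- Every representation has a reduction which is either at least as large as the canonical one at
every element, or has a ground set smaller than the poset. -/
theorem exists_isReduction [PartialOrder α] [Fintype α] {S : α → Finset β} (hS : IsRepr S) :
    ∃ T : α → Finset β, IsRepr T ∧ IsReduction T S ∧ (ground T).card ≤ Fintype.card α ∧
      ((ground T).card < Fintype.card α ∨ ∀ y, (downSet y).card ≤ (T y).card) := by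
  have hred : ∀ T : α → Finset β, (∀ x, T x ⊆ S x) → IsReduction T S := fun T hT =>
    ⟨Finset.card_le_card (Finset.biUnion_mono fun x _ => hT x),
      fun x => Finset.card_le_card (hT x)⟩
  by_cases hall : ∀ B : Finset α, B.card ≤ (B.biUnion S).card
  · obtain ⟨f, hf, hfS⟩ := (Finset.all_card_le_biUnion_card_iff_exists_injective S).1 hall
    obtain ⟨T, hT, hTS, hg, hd⟩ := exists_repr_of_injective hS ∅ (fun x => f x.1)
      (hf.comp Subtype.val_injective) (fun x => by simpa using hfS x)
    refine ⟨T, hT, hred T hTS, by simpa using hg, Or.inr fun y => by simpa using hd y⟩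
  · push Not at hall
    obtain ⟨B₀, hB₀⟩ := hall
    obtain ⟨A, -, hA⟩ := Finset.exists_max_image (Finset.univ : Finset (Finset α))
      (fun A => (A.card : ℤ) - (A.biUnion S).card) ⟨∅, Finset.mem_univ _⟩
    obtain ⟨f, hf, hfS⟩ := (Finset.all_card_le_biUnion_card_iff_exists_injective
      (fun x : {x // x ∉ A} => S x \ A.biUnion S)).1 (by
        intro B
        have h := hA (A ∪ B.map (Function.Embedding.subtype _)) (Finset.mem_univ _)
        have hdisj : Disjoint A (B.map (Function.Embedding.subtype _)) := by
          rw [Finset.disjoint_left]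
          intro x hx hxB
          obtain ⟨z, -, rfl⟩ := Finset.mem_map.1 hxB
          exact z.2 hx
        have hU : (A ∪ B.map (Function.Embedding.subtype _)).biUnion S =
            A.biUnion S ∪ B.biUnion (fun x => S x \ A.biUnion S) := by
          ext b
          simp only [Finset.mem_biUnion, Finset.mem_union, Finset.mem_map, Finset.mem_sdiff,
            Function.Embedding.coe_subtype]
          grind
        have hle := Finset.card_union_le (A.biUnion S)
          (B.biUnion fun x => S x \ A.biUnion S)
        simp only [hU, Finset.card_union_of_disjoint hdisj, Finset.card_map] at h
        omega)
    obtain ⟨T, hT, hTS, hg, -⟩ := exists_repr_of_injective hS A f hf hfS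
    have h := hA B₀ (Finset.mem_univ _)
    exact ⟨T, hT, hred T hTS, by omega, Or.inl (by omega)⟩

theorem IrreducibleRepr.card_ground_le [PartialOrder α] [Fintype α] {S : α → Finset ℕ}
    (hS : IrreducibleRepr S) : (ground S).card ≤ Fintype.card α := by
  obtain ⟨T, hT, hTS, hg, -⟩ := exists_isReduction hS.1
  exact (hS.2 T hT hTS).1.trans hg

theorem card_mem_upperBounds_iir (α : Type) [PartialOrder α] [Fintype α] :
    Fintype.card α ∈
      upperBounds {w | ∃ S : α → Finset ℕ, IrreducibleRepr S ∧ (ground S).card = w} := by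
  rintro _ ⟨S, hS, rfl⟩
  exact hS.card_ground_le

theorem iir_le_card (α : Type) [PartialOrder α] [Fintype α] : iir α ≤ Fintype.card α := by
  obtain h | h := Set.eq_empty_or_nonempty
    {w | ∃ S : α → Finset ℕ, IrreducibleRepr S ∧ (ground S).card = w}
  · simp [iir, h]
  · exact csSup_le h (card_mem_upperBounds_iir α)

theorem IrreducibleRepr.card_ground_le_iir [PartialOrder α] [Fintype α] [Countable γ]
    {S : α → Finset γ} (hS : IrreducibleRepr S) : (ground S).card ≤ iir α := by
  obtain ⟨f, hf⟩ := exists_injective_nat γ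
  refine le_csSup ⟨_, card_mem_upperBounds_iir α⟩
    ⟨fun x => (S x).map ⟨f, hf⟩, ⟨isRepr_map hS.1 _, fun T hT h => ?_⟩, card_ground_map _ _⟩
  simp only [IsReduction, card_ground_map, Finset.card_map] at h ⊢
  exact hS.2 T hT h

/-- If `iir α = |α|` then the canonical representation is irreducible. -/
theorem irreducibleRepr_canonical [PartialOrder α] [Fintype α] [Nonempty α]
    (h : iir α = Fintype.card α) : IrreducibleRepr (canonical α) := by
  have hne : {w | ∃ S : α → Finset ℕ, IrreducibleRepr S ∧ (ground S).card = w}.Nonempty := by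
    by_contra! hempty
    have hpos := Fintype.card_pos (α := α)
    simp [← h, iir, hempty] at hpos
  obtain ⟨S, hS, hcard⟩ := Nat.sSup_mem hne ⟨_, card_mem_upperBounds_iir α⟩
  replace hcard : (ground S).card = Fintype.card α := hcard.trans h
  obtain ⟨T, hT, hTS, -, hlt | hdown⟩ := exists_isReduction hS.1
  · have := (hS.2 T hT hTS).1
    omega
  have hred : IsReduction (canonical α) S :=
    ⟨by rw [ground_canonical, hcard, Finset.card_univ], fun x => (hdown x).trans (hTS.2 x)⟩
  refine ⟨isRepr_canonical, fun U hU hUc => ?_⟩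
  have hSU := hS.2 U hU ⟨hUc.1.trans hred.1, fun x => (hUc.2 x).trans (hred.2 x)⟩
  exact ⟨hred.1.trans hSU.1, fun x => (hred.2 x).trans (hSU.2 x)⟩

/-- When the canonical representation of a poset is irreducible, so is that of an up-set among
representations by non-empty sets. -/
theorem IrreducibleRepr.isReduction_canonical_upset [PartialOrder α] [Fintype α] [Countable γ]
    (hα : IrreducibleRepr (canonical α)) {Q : Set α} [Fintype Q]
    (hQ : ∀ u v : α, u ≤ v → u ∈ Q → v ∈ Q) {G : Q → Finset γ} (hG : IsRepr G)
    (hne : ∀ x, (G x).Nonempty) (hred : IsReduction G (canonical Q)) :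
    IsReduction (canonical Q) G := by
  let g : α → Finset γ := fun x => if h : x ∈ Q then G ⟨x, h⟩ else ∅
  have hg : ∀ x : Q, g x = G x := fun x => by simp [g]
  have hg' : ∀ x, x ∉ Q → g x = ∅ := fun x hx => by simp [g, hx]
  let F : α → Finset (γ ⊕ α) := fun x => (g x).disjSum ((downSet x).filter (· ∉ Q))
  have hF : IsRepr F := by
    intro x y
    constructor
    · intro h
      refine Finset.disjSum_mono ?_ ?_
      · by_cases hx : x ∈ Q
        · rw [hg ⟨x, hx⟩, hg ⟨y, hQ x y h hx⟩]
          exact (hG _ _).1 h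
        · simp [hg' x hx]
      · exact Finset.filter_subset_filter _ ((isRepr_canonical x y).1 h)
    · intro h
      by_cases hx : x ∈ Q
      · have hsub : g x ⊆ g y := fun b hb =>
          Finset.inl_mem_disjSum.1 (h (Finset.inl_mem_disjSum.2 hb))
        rw [hg ⟨x, hx⟩] at hsub
        by_cases hy : y ∈ Q
        · rw [hg ⟨y, hy⟩] at hsub
          exact (hG ⟨x, hx⟩ ⟨y, hy⟩).2 hsub
        · rw [hg' y hy, Finset.subset_empty] at hsub
          exact absurd hsub (hne _).ne_empty
      · have hmem : Sum.inr x ∈ F x :=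
          Finset.inr_mem_disjSum.2 (Finset.mem_filter.2 ⟨mem_downSet.2 le_rfl, hx⟩)
        exact mem_downSet.1 (Finset.mem_filter.1 (Finset.inr_mem_disjSum.1 (h hmem))).1
  have hground : (ground F).card ≤ (ground G).card + (Finset.univ.filter (· ∉ Q)).card := by
    rw [← Finset.card_disjSum]
    refine Finset.card_le_card fun b hb => ?_
    obtain ⟨x, hx⟩ := mem_ground.1 hb
    refine Finset.disjSum_mono ?_ (Finset.filter_subset_filter _ (Finset.subset_univ _)) hx
    intro c hc
    by_cases hxQ : x ∈ Q
    · rw [hg ⟨x, hxQ⟩] at hc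
      exact mem_ground.2 ⟨_, hc⟩
    · simp [hg' x hxQ] at hc
  have hsplit : Fintype.card α = Fintype.card Q + (Finset.univ.filter (· ∉ Q)).card := by
    rw [← Finset.card_univ, ← Finset.card_filter_add_card_filter_not (· ∈ Q), Fintype.card_subtype]
  have hdown : ∀ x : Q, (downSet (x : α)).card =
      (downSet x).card + ((downSet (x : α)).filter (· ∉ Q)).card := by
    intro x
    rw [← Finset.card_filter_add_card_filter_not (· ∈ Q),
      ← Finset.card_map (Function.Embedding.subtype (· ∈ Q)) (s := downSet x)]
    congr 2
    ext z
    simp [mem_downSet, ← Subtype.coe_le_coe]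
  have hcard : ∀ x, (F x).card = (g x).card + ((downSet x).filter (· ∉ Q)).card :=
    fun x => Finset.card_disjSum _ _
  simp only [IsReduction, ground_canonical, Finset.card_univ, canonical] at hred
  have hFred := hα.isReduction hF ⟨by
      rw [ground_canonical, Finset.card_univ]
      omega, fun x => by
      rw [hcard]
      by_cases hx : x ∈ Q
      · have h₁ := hred.2 ⟨x, hx⟩
        have h₂ := hdown ⟨x, hx⟩
        rw [hg ⟨x, hx⟩]
        simp only [canonical] at *
        omega
      · rw [hg' x hx, Finset.card_empty, zero_add]
        exact Finset.card_filter_le _ _⟩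
  simp only [IsReduction, ground_canonical, Finset.card_univ, canonical, hcard] at hFred ⊢
  refine ⟨by omega, fun x => ?_⟩
  have h₁ := hFred.2 x
  have h₂ := hdown x
  rw [hg x] at h₁
  omega

/-- The canonical representation with the point `m` deleted from the ground set. -/
noncomputable def canonicalErase [PartialOrder α] [Fintype α] (m : α) : α → Finset α :=
  fun x => (downSet x).erase m

theorem isRepr_canonicalErase [PartialOrder α] [Fintype α] {m : α} (hm : ∀ x, m ≤ x) :
    IsRepr (canonicalErase m) := by
  intro x y
  refine ⟨fun h => Finset.erase_subset_erase _ ((isRepr_canonical x y).1 h), fun h => ?_⟩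
  by_cases hx : x = m
  · exact hx ▸ hm y
  · exact mem_downSet.1 (Finset.mem_of_mem_erase
      (h (Finset.mem_erase.2 ⟨hx, mem_downSet.2 le_rfl⟩)))

theorem card_canonicalErase_add_one [PartialOrder α] [Fintype α] {m : α} (hm : ∀ x, m ≤ x)
    (x : α) : (canonicalErase m x).card + 1 = (canonical α x).card :=
  Finset.card_erase_add_one (mem_downSet.2 (hm x))

theorem card_ground_canonicalErase_add_one [PartialOrder α] [Fintype α] (m : α) :
    (ground (canonicalErase m)).card + 1 = Fintype.card α := by
  have h : ground (canonicalErase m) = Finset.univ.erase m := by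
    ext x
    simp only [mem_ground, canonicalErase, Finset.mem_erase, mem_downSet, Finset.mem_univ,
      and_true]
    exact ⟨fun ⟨_, h, _⟩ => h, fun h => ⟨x, h, le_rfl⟩⟩
  rw [h, Finset.card_erase_add_one (Finset.mem_univ m), Finset.card_univ]

theorem isRepr_insertNone [PartialOrder α] {S : α → Finset β} (hS : IsRepr S) :
    IsRepr fun x => Finset.insertNone (S x) := by
  intro x y
  rw [hS x y]
  exact Finset.insertNone.le_iff_le.symm

theorem card_ground_insertNone_le [Fintype α] (S : α → Finset β) :
    (ground fun x => Finset.insertNone (S x)).card ≤ (ground S).card + 1 := by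
  rw [← Finset.card_insertNone]
  refine Finset.card_le_card fun b hb => ?_
  obtain ⟨x, hx⟩ := mem_ground.1 hb
  exact Finset.insertNone.monotone (Finset.subset_biUnion_of_mem S (Finset.mem_univ x)) hx

/-- When the canonical representation of a poset is irreducible and `m` is the least element of an
up-set, the canonical representation of the up-set without `m` is irreducible. -/
theorem IrreducibleRepr.canonicalErase_upset [PartialOrder α] [Fintype α]
    (hα : IrreducibleRepr (canonical α)) {Q : Set α} [Fintype Q]
    (hQ : ∀ u v : α, u ≤ v → u ∈ Q → v ∈ Q) {m : Q} (hm : ∀ x, m ≤ x) :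
    IrreducibleRepr (canonicalErase m) := by
  have hmem := card_canonicalErase_add_one hm
  have hg := card_ground_canonicalErase_add_one m
  refine ⟨isRepr_canonicalErase hm, fun T hT hred => ?_⟩
  have hTg := card_ground_insertNone_le T
  have h := hα.isReduction_canonical_upset hQ (isRepr_insertNone hT)
    (fun x => ⟨none, Finset.none_mem_insertNone⟩)
    ⟨by
      rw [ground_canonical, Finset.card_univ]
      have := hred.1
      omega, fun x => by
      rw [Finset.card_insertNone, ← hmem x]
      exact Nat.succ_le_succ (hred.2 x)⟩
  refine ⟨?_, fun x => ?_⟩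
  · have h₁ := h.1
    rw [ground_canonical, Finset.card_univ] at h₁
    omega
  · have h₁ := h.2 x
    rw [Finset.card_insertNone, ← hmem x] at h₁
    omega

end Representations

/-- non-empty up-sets of posets with `iir P = |P|` are in `NMIIR`:
either `iir Q = |Q|`, or `iir Q = |Q| - 1` and the first block of `Q` is a chain
(equivalently, `Q` has a non-empty chain `C` all of whose elements lie below all
elements of `Q \ C`). -/
theorem upset_NMIIR (α : Type) [PartialOrder α] [Fintype α] [Nonempty α]
    (hiir : iir α = Fintype.card α)
    (Q : Set α) (hQne : Q.Nonempty) (hQ : ∀ u v : α, u ≤ v → u ∈ Q → v ∈ Q) :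
    iir ↥Q = Fintype.card ↥Q ∨
      (iir ↥Q = Fintype.card ↥Q - 1 ∧
        ∃ C : Set α, C ⊆ Q ∧ C.Nonempty ∧ IsChain (· ≤ ·) C ∧
          ∀ x ∈ C, ∀ y ∈ Q, y ∉ C → x < y) := by
  have hα := irreducibleRepr_canonical hiir
  have hle := iir_le_card ↥Q
  by_cases hmin : ∃ m : Q, ∀ x, m ≤ x
  · obtain ⟨m, hm⟩ := hmin
    have h := (hα.canonicalErase_upset hQ hm).card_ground_le_iir
    have hg := card_ground_canonicalErase_add_one m
    by_cases heq : iir ↥Q = Fintype.card ↥Q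
    · exact Or.inl heq
    · refine Or.inr ⟨by omega, {m.1}, by simp, by simp, by simp, ?_⟩
      rintro _ rfl y hy hym
      exact lt_of_le_of_ne (hm ⟨y, hy⟩) fun h => hym h.symm
  · push Not at hmin
    have hirr : IrreducibleRepr (canonical Q) := by
      refine ⟨isRepr_canonical, fun T hT hred => ?_⟩
      refine hα.isReduction_canonical_upset hQ hT (fun x => ?_) hred
      by_contra hx
      obtain ⟨y, hy⟩ := hmin x
      refine hy ((hT x y).2 ?_)
      simp [Finset.not_nonempty_iff_eq_empty.1 hx]
    have h := hirr.card_ground_le_iir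
    rw [ground_canonical, Finset.card_univ] at h
    exact Or.inl (le_antisymm hle h)
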